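/- arXiv:2511.01003 — 8 statements merged into one kernel-verified Lean document; each statement's English description precedes it below -/
import Mathlib

section
/- Let n be a positive integer, q = 2^n, and A, B, C, D, E ∈ 𝔽_{q²}. The Dillon hexanomial f_{A,B,C,D,E} is APN if and only if every pair (a, x) ∈ 𝔽_{q²} × 𝔽_{q²} satisfying (A·a + E·a^{2q} + D·a^q)·x² + (A·a² + C·a^{2q} + B·a^q)·x + (E·a² + C·a + a^q)·x^{2q} + (D·a² + B·a + a^{2q})·x^q = 0 has a = 0 or x = 0 or x = a. -/
/-- A function `f : F → F` is almost perfect nonlinear (APN) if for every nonzero `a`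
and every `b`, the equation `f (x + a) + f x = b` has at most two solutions. -/
def IsAPN {F : Type*} [Field F] (f : F → F) : Prop :=
  ∀ a b : F, a ≠ 0 → Set.ncard {x : F | f (x + a) + f x = b} ≤ 2

/-- The Dillon hexanomial `f_{A,B,C,D,E}(x) = A x³ + B x^{q+1} + C x^{2q+1} + D x^{q+2}
+ E x^{2q+2} + x^{3q}`. -/
def dillon {F : Type*} [Field F] (q : ℕ) (A B C D E : F) : F → F :=
  fun x => A * x ^ 3 + B * x ^ (q + 1) + C * x ^ (2 * q + 1) +
    D * x ^ (q + 2) + E * x ^ (2 * q + 2) + x ^ (3 * q)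

/-- Condition (C1): `A ≠ 0`, `C = D = 0`, `A^q B = B^q`, `A^q E = E^q`. -/
def CondC1 {F : Type*} [Field F] (q : ℕ) (A B C D E : F) : Prop :=
  A ≠ 0 ∧ C = 0 ∧ D = 0 ∧ A ^ q * B = B ^ q ∧ A ^ q * E = E ^ q

/-- Condition (C2): `A ≠ 0`, `C ≠ 0`, `D ≠ 0`, `A^{q+1} = 1`, `D = A C^q`,
`B^q = A^q B`, `E^q = A^q E`. -/
def CondC2 {F : Type*} [Field F] (q : ℕ) (A B C D E : F) : Prop :=
  A ≠ 0 ∧ C ≠ 0 ∧ D ≠ 0 ∧ A ^ (q + 1) = 1 ∧ D = A * C ^ q ∧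
    B ^ q = A ^ q * B ∧ E ^ q = A ^ q * E

/-- The key quantity `h₁` from the paper. -/
def h1Poly {F : Type*} [Field F] (q : ℕ) (A B C D : F) : F :=
  A ^ (q + 1) * B ^ (q + 1) + A * B ^ (2 * q) + A ^ q * B ^ 2 +
    B ^ 2 * C ^ q * D ^ q + B ^ (q + 1) * C ^ (q + 1) +
    B ^ (q + 1) * D ^ (q + 1) + B ^ (q + 1) + B ^ (2 * q) * C * D

/-- The bilinear form attached to the Dillon hexanomial, as a function of `x` for fixed `a`. -/
def dillonForm {F : Type*} [Field F] (q : ℕ) (A B C D E a x : F) : F :=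
  (A * a + E * a ^ (2 * q) + D * a ^ q) * x ^ 2 +
    (A * a ^ 2 + C * a ^ (2 * q) + B * a ^ q) * x +
    (E * a ^ 2 + C * a + a ^ q) * x ^ (2 * q) +
    (D * a ^ 2 + B * a + a ^ (2 * q)) * x ^ q

theorem dillon_add_add_dillon {F : Type*} [Field F] [CharP F 2] (n : ℕ) (A B C D E a x : F) :
    dillon (2 ^ n) A B C D E (x + a) + dillon (2 ^ n) A B C D E x =
      dillonForm (2 ^ n) A B C D E a x + dillon (2 ^ n) A B C D E a := by
  have h2 : (2 : F) = 0 := CharTwo.two_eq_zero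
  simp only [dillon, dillonForm, pow_add, mul_comm _ (2 ^ n), pow_mul, add_pow_char_pow]
  generalize x ^ 2 ^ n = y
  generalize a ^ 2 ^ n = b
  grind

theorem dillonForm_add {F : Type*} [Field F] [CharP F 2] (n : ℕ) (A B C D E a x y : F) :
    dillonForm (2 ^ n) A B C D E a (x + y) =
      dillonForm (2 ^ n) A B C D E a x + dillonForm (2 ^ n) A B C D E a y := by
  simp only [dillonForm, mul_comm 2 (2 ^ n), pow_mul, add_pow_char_pow, CharTwo.add_sq]
  ring

theorem dillonForm_zero {F : Type*} [Field F] (n : ℕ) (A B C D E a : F) :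
    dillonForm (2 ^ n) A B C D E a 0 = 0 := by
  simp [dillonForm]

theorem dillonForm_self {F : Type*} [Field F] [CharP F 2] (n : ℕ) (A B C D E a : F) :
    dillonForm (2 ^ n) A B C D E a a = 0 := by
  have h2 : (2 : F) = 0 := CharTwo.two_eq_zero
  simp only [dillonForm, mul_comm 2 (2 ^ n), pow_mul]
  generalize a ^ 2 ^ n = b
  linear_combination
    (A * a ^ 3 + E * a ^ 2 * b ^ 2 + D * a ^ 2 * b + C * a * b ^ 2 + B * a * b + b ^ 3) * h2

theorem statement0 (n q : ℕ) (hn : 0 < n) (hq : q = 2 ^ n)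
    (F : Type) [Field F] [Fintype F] (hF : Fintype.card F = q ^ 2)
    (A B C D E : F) :
    IsAPN (dillon q A B C D E) ↔
      ∀ a x : F,
        (A * a + E * a ^ (2 * q) + D * a ^ q) * x ^ 2 +
            (A * a ^ 2 + C * a ^ (2 * q) + B * a ^ q) * x +
            (E * a ^ 2 + C * a + a ^ q) * x ^ (2 * q) +
            (D * a ^ 2 + B * a + a ^ (2 * q)) * x ^ q = 0 →
          a = 0 ∨ x = 0 ∨ x = a := by
  subst hq
  have h2 : (2 : F) = 0 := by
    have h := Nat.cast_card_eq_zero F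
    rw [hF] at h
    simpa [hn.ne'] using h
  have : CharP F 2 := CharTwo.of_one_ne_zero_of_two_eq_zero one_ne_zero h2
  change _ ↔ ∀ a x : F, dillonForm (2 ^ n) A B C D E a x = 0 → a = 0 ∨ x = 0 ∨ x = a
  simp only [IsAPN, dillon_add_add_dillon]
  constructor
  · intro h a x hx
    by_contra! hne
    obtain ⟨ha, hx0, hxa⟩ := hne
    refine (h a (dillon (2 ^ n) A B C D E a) ha).not_gt ?_
    rw [Set.two_lt_ncard]
    exact ⟨0, by simp [dillonForm_zero], a, by simp [dillonForm_self], x, by simp [hx],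
      ha.symm, hx0.symm, hxa.symm⟩
  · intro h a b ha
    by_contra! hlt
    rw [Set.two_lt_ncard] at hlt
    obtain ⟨x, hx, y, hy, z, hz, hxy, hxz, hyz⟩ := hlt
    have key : ∀ {u v : F}, dillonForm (2 ^ n) A B C D E a u + dillon (2 ^ n) A B C D E a = b →
        dillonForm (2 ^ n) A B C D E a v + dillon (2 ^ n) A B C D E a = b → u ≠ v →
        u + v = a := by
      intro u v hu hv huv
      have hform : dillonForm (2 ^ n) A B C D E a (u + v) = 0 := by
        rw [dillonForm_add, CharTwo.add_eq_zero]
        exact add_right_cancel (hu.trans hv.symm)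
      rcases h a _ hform with h0 | h0 | h0
      · exact absurd h0 ha
      · exact absurd (CharTwo.add_eq_zero.mp h0) huv
      · exact h0
    exact hyz (add_left_cancel ((key hx hy hxy).trans (key hx hz hxz).symm))
end

section
/- Let n be a positive integer, q = 2^n, and A, B, C, D, E ∈ 𝔽_{q²}. Suppose the following seven equations hold: C^q E + D E^q = 0; B E^q + B^q E + C^{q+1} + D^{q+1} = 0; A^q E + E^q = 0; A^q D + C^q = 0; B D^q + B^q C = 0; A^q C + D^q = 0; and A^q B + B^q = 0. Then either A = B = C = D = E = 0, or condition (C1) holds, or condition (C2) holds. -/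
theorem statement1 (n q : ℕ) (hn : 0 < n) (hq : q = 2 ^ n)
    (F : Type) [Field F] [Fintype F] (hF : Fintype.card F = q ^ 2)
    (A B C D E : F)
    (e1 : C ^ q * E + D * E ^ q = 0)
    (e2 : B * E ^ q + B ^ q * E + C ^ (q + 1) + D ^ (q + 1) = 0)
    (e3 : A ^ q * E + E ^ q = 0)
    (e4 : A ^ q * D + C ^ q = 0)
    (e5 : B * D ^ q + B ^ q * C = 0)
    (e6 : A ^ q * C + D ^ q = 0)
    (e7 : A ^ q * B + B ^ q = 0) :
    (A = 0 ∧ B = 0 ∧ C = 0 ∧ D = 0 ∧ E = 0) ∨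
      CondC1 q A B C D E ∨ CondC2 q A B C D E := by
  have hq0 : q ≠ 0 := by rw [hq]; positivity
  have h2 : (2 : F) = 0 := by
    have h := FiniteField.cast_card_eq_zero F
    rw [hF, hq] at h
    push_cast at h
    exact eq_zero_of_pow_eq_zero (eq_zero_of_pow_eq_zero h)
  have hEq : A ^ q * E = E ^ q := by linear_combination e3 - E ^ q * h2
  have hBq : A ^ q * B = B ^ q := by linear_combination e7 - B ^ q * h2
  have hCq : C ^ q = A ^ q * D := by linear_combination e4 - A ^ q * D * h2
  have hDq : D ^ q = A ^ q * C := by linear_combination e6 - A ^ q * C * h2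
  have hfrob (x : F) : (x ^ q) ^ q = x := by
    rw [← pow_mul, ← sq, ← hF, FiniteField.pow_card]
  by_cases hA : A = 0
  · subst hA
    simp only [zero_pow hq0, zero_mul] at hEq hBq hCq hDq
    exact Or.inl ⟨rfl, eq_zero_of_pow_eq_zero hBq.symm, eq_zero_of_pow_eq_zero hCq,
      eq_zero_of_pow_eq_zero hDq, eq_zero_of_pow_eq_zero hEq.symm⟩
  by_cases hC : C = 0
  · have hD : D = 0 := by
      rw [hC, mul_zero] at hDq
      exact eq_zero_of_pow_eq_zero hDq
    exact Or.inr (Or.inl ⟨hA, hC, hD, hBq, hEq⟩)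
  · have hD : D ≠ 0 := by
      rintro rfl
      rw [mul_zero] at hCq
      exact hC (eq_zero_of_pow_eq_zero hCq)
    have hnorm : A ^ (q + 1) = 1 := by
      have h := hfrob C
      rw [hCq, mul_pow, hfrob, hDq] at h
      refine mul_right_cancel₀ hC ?_
      linear_combination h
    refine Or.inr (Or.inr ⟨hA, hC, hD, hnorm, ?_, hBq.symm, hEq.symm⟩)
    linear_combination -A * hCq - D * hnorm
end

section
/- There exists a positive integer n₀ such that for every integer n ≥ n₀, setting q = 2^n, and for all A, B, C, D, E ∈ 𝔽_{q²} satisfying condition (C1), the Dillon hexanomial f_{A,B,C,D,E} is APN if and only if A^{q+1} ≠ 1. -/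
theorem pow_succ_eq_one_of_mul_eq_pow {F : Type*} [Field F] [Fintype F] {q : ℕ}
    (hF : Fintype.card F = q ^ 2) {c w : F} (hw : w ≠ 0) (h : c * w = w ^ q) :
    c ^ (q + 1) = 1 := by
  have hwq : w ^ (q * q) = w := by rw [← sq, ← hF, FiniteField.pow_card]
  have h2 : c ^ q * w ^ q = w := by rw [← mul_pow, h, ← pow_mul, hwq]
  apply mul_right_cancel₀ hw
  rw [pow_succ, mul_assoc, h, h2, one_mul]

theorem pow_pow_succ_of_card {F : Type*} [Field F] [Fintype F] {q : ℕ}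
    (hF : Fintype.card F = q ^ 2) (c : F) : (c ^ q) ^ (q + 1) = c ^ (q + 1) := by
  have hc : c ^ (q * q) = c := by rw [← sq, ← hF, FiniteField.pow_card]
  rw [← pow_mul, mul_add, pow_add, hc, mul_one, pow_succ, mul_comm]

theorem isAPN_cube_add_cube_pow {F : Type*} [Field F] [Fintype F] [CharP F 2] {n q : ℕ}
    (hq : q = 2 ^ n) (hF : Fintype.card F = q ^ 2) {A : F} (hA : A ^ (q + 1) ≠ 1) :
    IsAPN (fun x : F => A * x ^ 3 + (x ^ 3) ^ q) := by
  have two : (2 : F) = 0 := CharTwo.two_eq_zero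
  have hadd : ∀ u v : F, (u + v) ^ q = u ^ q + v ^ q := by
    subst hq
    exact fun u v => add_pow_char_pow u v 2 n
  intro a b ha
  rcases Set.eq_empty_or_nonempty
    {x : F | (A * (x + a) ^ 3 + ((x + a) ^ 3) ^ q) + (A * x ^ 3 + (x ^ 3) ^ q) = b} with
    h | ⟨x, hx⟩
  · rw [h]; simp
  refine (Set.ncard_le_ncard (t := {x, x + a}) ?_).trans (by simpa using Set.ncard_insert_le x {x + a})
  intro y hy
  have hL : A * (((x + a) ^ 3 + x ^ 3) + ((y + a) ^ 3 + y ^ 3)) =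
      (((x + a) ^ 3 + x ^ 3) + ((y + a) ^ 3 + y ^ 3)) ^ q := by
    simp only [Set.mem_ofPred_eq] at hx hy
    simp only [hadd]
    linear_combination hx + hy - (((x + a) ^ 3) ^ q + (x ^ 3) ^ q +
      ((y + a) ^ 3) ^ q + (y ^ 3) ^ q - b) * two
  have h0 : ((x + a) ^ 3 + x ^ 3) + ((y + a) ^ 3 + y ^ 3) = 0 := by
    by_contra hw
    exact hA (pow_succ_eq_one_of_mul_eq_pow hF hw hL)
  have hprod : a * ((y - x) * (y - (x + a))) = 0 := by
    linear_combination h0 - (x ^ 3 + y ^ 3 + a ^ 3 + x ^ 2 * a + x * a ^ 2 + y ^ 2 * a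
      + 2 * y * a ^ 2 + x * y * a) * two
  rcases mul_eq_zero.1 ((mul_eq_zero.1 hprod).resolve_left ha) with h | h
  · exact Or.inl (sub_eq_zero.1 h)
  · exact Or.inr (sub_eq_zero.1 h)

theorem card_le_two_mul_of_isAPN {F : Type*} [Field F] [Fintype F] {f : F → F} (hf : IsAPN f)
    (s : Finset F) (hs : ∀ x, f (x + 1) + f x ∈ s) : Fintype.card F ≤ 2 * s.card := by
  classical
  refine Finset.card_le_mul_card_image_of_maps_to (s := Finset.univ) (fun x _ => hs x) 2 ?_
  intro b _
  have h := hf 1 b one_ne_zero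
  simpa [Set.ncard_eq_toFinset_card'] using h

theorem card_filter_mul_eq_pow_le {F : Type*} [Field F] [Fintype F] [DecidableEq F] {q : ℕ}
    (hq : 1 < q) (c : F) : (Finset.univ.filter fun y : F => c * y = y ^ q).card ≤ q := by
  open Polynomial in
  have hdeg : (X ^ q - C c * X : F[X]).natDegree = q := by
    rw [natDegree_sub_eq_left_of_natDegree_lt, natDegree_X_pow]
    rw [natDegree_X_pow]
    exact (natDegree_C_mul_le c X).trans_lt (by simpa using hq)
  have hne : (X ^ q - C c * X : F[X]) ≠ 0 := by
    intro h
    rw [h, natDegree_zero] at hdeg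
    omega
  refine le_of_le_of_eq ?_ hdeg
  refine (Finset.card_le_card (t := (X ^ q - C c * X : F[X]).roots.toFinset) ?_).trans
    ((Multiset.toFinset_card_le _).trans (card_roots' _))
  intro y hy
  simp only [Finset.mem_filter, Finset.mem_univ, true_and] at hy
  simp [hne, hy]

theorem statement2 :
    ∃ n₀ : ℕ, 0 < n₀ ∧ ∀ n : ℕ, n₀ ≤ n → ∀ q : ℕ, q = 2 ^ n →
      ∀ (F : Type) [Field F] [Fintype F], Fintype.card F = q ^ 2 →
        ∀ A B C D E : F, CondC1 q A B C D E →
          (IsAPN (dillon q A B C D E) ↔ A ^ (q + 1) ≠ 1) := by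
  refine ⟨2, two_pos, ?_⟩
  intro n hn q hq F _ _ hF A B C D E ⟨hA0, hC, hD, hB, hE⟩
  have hchar : CharP F 2 := by
    refine charP_of_card_eq_prime_pow (f := n * 2) ?_
    rw [hF, hq, pow_mul]
  have hadd : ∀ u v : F, (u + v) ^ q = u ^ q + v ^ q := by
    subst hq
    exact fun u v => add_pow_char_pow u v 2 n
  have hq4 : 4 ≤ q := by
    rw [hq]
    exact Nat.pow_le_pow_right (n := 2) two_pos hn
  have hpow : ∀ x : F, x ^ (q * q) = x := fun x => by
    rw [← sq, ← hF, FiniteField.pow_card]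
  subst hC hD
  constructor
  · intro hf hA
    classical
    have hsub : ∀ x, A ^ q * dillon q A B 0 0 E x = dillon q A B 0 0 E x ^ q := by
      intro x
      have hA' : A ^ q * A = 1 := by rw [← pow_succ, hA]
      have h1 : (x ^ 3) ^ q = x ^ (3 * q) := by rw [← pow_mul]
      have h2 : (x ^ (q + 1)) ^ q = x ^ (q + 1) := by
        rw [← pow_mul, add_mul, pow_add, hpow, one_mul, pow_succ, mul_comm]
      have h3 : (x ^ (2 * q + 2)) ^ q = x ^ (2 * q + 2) := by
        rw [show 2 * q + 2 = (q + 1) * 2 by ring, pow_mul, ← pow_mul, mul_comm 2 q, pow_mul, h2]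
      have h4 : (x ^ (3 * q)) ^ q = x ^ 3 := by
        rw [← pow_mul, mul_assoc, mul_comm, pow_mul, hpow]
      simp only [dillon, zero_mul, add_zero, hadd, mul_pow, h1, h2, h3, h4, ← hB, ← hE]
      linear_combination x ^ 3 * hA'
    have hcard := card_le_two_mul_of_isAPN hf
      (Finset.univ.filter fun y : F => A ^ q * y = y ^ q) (fun x => by
        simp only [Finset.mem_filter, Finset.mem_univ, true_and, hadd, mul_add, hsub])
    have hle := card_filter_mul_eq_pow_le (q := q) (by omega) (A ^ q)
    rw [hF] at hcard
    nlinarith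
  · intro hA
    have hzero : ∀ w : F, A ^ q * w = w ^ q → w = 0 := by
      intro w h
      by_contra hw
      exact hA (pow_pow_succ_of_card hF A ▸ pow_succ_eq_one_of_mul_eq_pow hF hw h)
    have hfun : dillon q A B 0 0 E = fun x => A * x ^ 3 + (x ^ 3) ^ q := by
      funext x
      simp [dillon, hzero B hB, hzero E hE, pow_mul]
    rw [hfun]
    exact isAPN_cube_add_cube_pow hq hF hA
end

section
/- There exists a positive integer n₀ such that for every integer n ≥ n₀, setting q = 2^n, and for all A, B, C, D, E ∈ 𝔽_{q²} satisfying condition (C2), the Dillon hexanomial f_{A,B,C,D,E} is not APN. -/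
/-- Under condition (C2) every value of the Dillon hexanomial is a fixed point of the
semilinear map `y ↦ A y^q`. -/
theorem CondC2.mul_dillon_pow {F : Type*} [Field F] {q : ℕ}
    (hadd : ∀ x y : F, (x + y) ^ q = x ^ q + y ^ q) (hinv : ∀ x : F, (x ^ q) ^ q = x)
    {A B C D E : F} (h : CondC2 q A B C D E) (x : F) :
    A * dillon q A B C D E x ^ q = dillon q A B C D E x := by
  obtain ⟨-, -, -, hA, rfl, hB, hE⟩ := h
  have hA' : A ^ q * A = 1 := by rw [← pow_succ, hA]
  have hswap : ∀ (y : F) (k : ℕ), (y ^ k) ^ q = (y ^ q) ^ k := fun y k => pow_right_comm y k q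
  have hform : dillon q A B C (A * C ^ q) E x =
      A * x ^ 3 + B * (x ^ q * x) + C * ((x ^ q) ^ 2 * x) + A * C ^ q * (x ^ q * x ^ 2) +
        E * ((x ^ q) ^ 2 * x ^ 2) + (x ^ q) ^ 3 := by
    simp only [dillon]
    ring
  rw [hform]
  simp only [hadd, mul_pow, hswap, hinv, hB, hE]
  linear_combination (x ^ q * x * B + (x ^ q) ^ 2 * x ^ 2 * E + (x ^ q) ^ 3 +
    C * ((x ^ q) ^ 2 * x)) * hA'

/-- The equation `A y^q = y` has at most `q` solutions when `1 < q` and `A ≠ 0`. -/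
theorem card_filter_mul_pow_eq_self_le {F : Type*} [Field F] [Fintype F] [DecidableEq F]
    {q : ℕ} (hq : 1 < q) {A : F} (hA : A ≠ 0) :
    (Finset.univ.filter fun y : F => A * y ^ q = y).card ≤ q := by
  let p : Polynomial F := Polynomial.C A * Polynomial.X ^ q - Polynomial.X
  have hdeg : p.natDegree = q := by
    have h1 : (Polynomial.C A * Polynomial.X ^ q).natDegree = q :=
      Polynomial.natDegree_C_mul_X_pow q A hA
    rw [Polynomial.natDegree_sub_eq_left_of_natDegree_lt, h1]
    rwa [h1, Polynomial.natDegree_X]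
  have hp : p ≠ 0 := by
    intro h
    rw [h, Polynomial.natDegree_zero] at hdeg
    omega
  calc (Finset.univ.filter fun y : F => A * y ^ q = y).card
      ≤ p.roots.toFinset.card := by
        refine Finset.card_le_card fun y hy => ?_
        simpa [hp, p, sub_eq_zero] using hy
    _ ≤ p.natDegree := (Multiset.toFinset_card_le _).trans p.card_roots'
    _ = q := hdeg

theorem statement3 :
    ∃ n₀ : ℕ, 0 < n₀ ∧ ∀ n : ℕ, n₀ ≤ n → ∀ q : ℕ, q = 2 ^ n →
      ∀ (F : Type) [Field F] [Fintype F], Fintype.card F = q ^ 2 →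
        ∀ A B C D E : F, CondC2 q A B C D E →
          ¬ IsAPN (dillon q A B C D E) := by
  classical
  refine ⟨2, two_pos, ?_⟩
  rintro n hn q rfl F _ _ hcard A B C D E hC2 hAPN
  have hn4 : 4 ≤ 2 ^ n := Nat.pow_le_pow_right two_pos hn
  have : CharP F 2 := charP_of_card_eq_prime_pow (f := n * 2) (by rw [hcard, pow_mul])
  set q := 2 ^ n
  have hadd : ∀ x y : F, (x + y) ^ q = x ^ q + y ^ q := fun x y => add_pow_char_pow x y 2 n
  have hinv : ∀ x : F, (x ^ q) ^ q = x := fun x => by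
    rw [← pow_mul, ← sq, ← hcard, FiniteField.pow_card]
  have hfix := hC2.mul_dillon_pow hadd hinv
  obtain ⟨b, -, hb⟩ := Finset.exists_lt_card_fiber_of_mul_lt_card_of_maps_to
    (s := (Finset.univ : Finset F)) (t := Finset.univ.filter fun y : F => A * y ^ q = y)
    (f := fun x => dillon q A B C D E (x + 1) + dillon q A B C D E x) (n := 2)
    (fun x _ => by simp [hadd, mul_add, hfix])
    (by
      have := card_filter_mul_pow_eq_self_le (F := F) (q := q) (by omega) hC2.1
      rw [Finset.card_univ, hcard]
      nlinarith)
  have hle := hAPN 1 b one_ne_zero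
  rw [Set.ncard_eq_toFinset_card', Set.toFinset_ofPred] at hle
  omega
end

section
/- Let n ≥ 20 be an integer, q = 2^n (so q ≥ 2^{20}), and A, B, C, D, E ∈ 𝔽_{q²} such that neither condition (C1) nor condition (C2) holds, B = 0, and A C^q + D = 0. If A^{q+1} = 1, C^{q+1} ≠ 1, A E^q + E ≠ 0, and there exists k ∈ 𝔽_{q²} with k^{q+1} = 1 and k³ + C k² + A C^q k + A = 0, then the Dillon hexanomial f_{A,B,C,D,E} is not APN. -/
/-- Hilbert 90 for the quadratic extension of finite fields `F / 𝔽_q`. -/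
theorem exists_pow_eq_mul {F : Type*} [Field F] [Fintype F] {q : ℕ} (hq : 1 < q)
    (hF : Fintype.card F = q ^ 2) {k : F} (hk : k ^ (q + 1) = 1) :
    ∃ a : F, a ≠ 0 ∧ a ^ q = k * a := by
  classical
  obtain ⟨g, hg⟩ := IsCyclic.exists_generator (α := Fˣ)
  obtain ⟨r, rfl⟩ : ∃ r, q = r + 1 := ⟨q - 1, by omega⟩
  have hord : orderOf g = r * (r + 1 + 1) := by
    rw [orderOf_eq_card_of_forall_mem_zpowers hg, Nat.card_eq_fintype_card,
      Fintype.card_units, hF, show (r + 1) ^ 2 = r * (r + 1 + 1) + 1 by ring,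
      Nat.add_sub_cancel]
  have hk0 : k ≠ 0 := by
    rintro rfl
    simp at hk
  obtain ⟨m, hm⟩ := (mem_powers_iff_mem_zpowers (x := g)).2 (hg (Units.mk0 k hk0))
  replace hm : g ^ m = Units.mk0 k hk0 := hm
  have hdvd : r * (r + 1 + 1) ∣ m * (r + 1 + 1) := by
    rw [← hord]
    apply orderOf_dvd_of_pow_eq_one
    rw [pow_mul, hm]
    ext
    simpa using hk
  obtain ⟨j, rfl⟩ := Nat.dvd_of_mul_dvd_mul_right (by omega) hdvd
  refine ⟨(g ^ j : Fˣ), Units.ne_zero _, ?_⟩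
  have hkg : k = ((g ^ (r * j) : Fˣ) : F) := by rw [hm, Units.val_mk0]
  rw [hkg]
  push_cast
  ring

/-- The subfield of order `q > 2` contains an element other than `0` and `1`. -/
theorem exists_pow_eq_self {F : Type*} [Field F] [Fintype F] {q : ℕ} (hq : 2 < q)
    (hF : Fintype.card F = q ^ 2) : ∃ t : F, t ^ q = t ∧ t ≠ 0 ∧ t ≠ 1 := by
  classical
  obtain ⟨g, hg⟩ := IsCyclic.exists_generator (α := Fˣ)
  have hcard : Fintype.card Fˣ + 1 = q ^ 2 := by
    rw [← hF, Fintype.card_eq_card_units_add_one (α := F)]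
  have hord : orderOf g = Fintype.card Fˣ := by
    rw [orderOf_eq_card_of_forall_mem_zpowers hg, Nat.card_eq_fintype_card]
  refine ⟨(g ^ (q + 1) : Fˣ), ?_, Units.ne_zero _, ?_⟩
  · have hpow : (g : F) ^ q ^ 2 = g := by rw [← hF, FiniteField.pow_card]
    push_cast
    rw [← pow_mul, show (q + 1) * q = q ^ 2 + q by ring, pow_add, hpow]
    ring
  · intro h
    have hdvd := orderOf_dvd_of_pow_eq_one (Units.ext h)
    have := Nat.le_of_dvd (by omega) hdvd
    nlinarith

theorem dillon_eq_of_pow_eq_mul {F : Type*} [Field F] {q : ℕ} {A C D E k x : F}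
    (hx : x ^ q = k * x) (hk : k ^ 3 + C * k ^ 2 + D * k + A = 0) :
    dillon q A 0 C D E x = E * k ^ 2 * x ^ 4 := by
  have h2 : x ^ (2 * q) = (k * x) ^ 2 := by rw [mul_comm, pow_mul, hx]
  have h3 : x ^ (3 * q) = (k * x) ^ 3 := by rw [mul_comm, pow_mul, hx]
  simp only [dillon, pow_add, h2, h3, hx]
  linear_combination x ^ 3 * hk

theorem statement5 (n q : ℕ) (hn : 20 ≤ n) (hq : q = 2 ^ n)
    (F : Type) [Field F] [Fintype F] (hF : Fintype.card F = q ^ 2)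
    (A B C D E : F)
    (hC1 : ¬ CondC1 q A B C D E) (hC2 : ¬ CondC2 q A B C D E)
    (hB : B = 0) (hD : A * C ^ q + D = 0)
    (hA : A ^ (q + 1) = 1) (hC : C ^ (q + 1) ≠ 1)
    (hE : A * E ^ q + E ≠ 0)
    (hk : ∃ k : F, k ^ (q + 1) = 1 ∧
      k ^ 3 + C * k ^ 2 + A * C ^ q * k + A = 0) :
    ¬ IsAPN (dillon q A B C D E) := by
  subst hB
  obtain ⟨k, hk1, hk⟩ := hk
  have hq2 : 2 < q := by
    have := Nat.pow_le_pow_right (n := 2) (by norm_num) hn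
    omega
  have : CharP F 2 := by
    have : Fact (Nat.Prime 2) := ⟨Nat.prime_two⟩
    exact charP_of_card_eq_prime_pow (f := n * 2) (by rw [hF, hq, pow_mul])
  obtain rfl : A * C ^ q = D := CharTwo.add_eq_zero.1 hD
  obtain ⟨a, ha0, ha⟩ := exists_pow_eq_mul (by omega) hF hk1
  obtain ⟨t, ht, ht0, ht1⟩ := exists_pow_eq_self hq2 hF
  have hadd (u v : F) : (u + v) ^ q = u ^ q + v ^ q := by
    rw [hq, add_pow_char_pow]
  have hval {s : F} (hs : s ^ q = s) :
      dillon q A 0 C (A * C ^ q) E (s * a) = E * k ^ 2 * (s * a) ^ 4 :=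
    dillon_eq_of_pow_eq_mul (by rw [mul_pow, hs, ha]; ring) hk
  have hsol {s : F} (hs : s ^ q = s) :
      dillon q A 0 C (A * C ^ q) E (s * a + a) + dillon q A 0 C (A * C ^ q) E (s * a) =
        E * k ^ 2 * a ^ 4 := by
    rw [show s * a + a = (s + 1) * a by ring, hval (by rw [hadd, hs, one_pow]), hval hs]
    linear_combination
      (E * k ^ 2 * a ^ 4 * (s ^ 4 + 2 * s ^ 3 + 3 * s ^ 2 + 2 * s)) *
        CharTwo.two_eq_zero (R := F)
  intro hapn
  have hle := (Set.ncard_le_ncard (s := {0, a, t * a}) (by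
    rintro x (rfl | rfl | rfl)
    · simpa using hsol (s := 0) (zero_pow (by omega))
    · simpa using hsol (s := 1) (one_pow q)
    · exact hsol ht) (Set.toFinite _)).trans (hapn a (E * k ^ 2 * a ^ 4) ha0)
  rw [Set.ncard_eq_three.2 ⟨0, a, t * a, ha0.symm, (mul_ne_zero ht0 ha0).symm,
    fun h => ht1 (mul_right_cancel₀ ha0 (by rw [one_mul, ← h])), rfl⟩] at hle
  omega
end

section
/- Let n ≥ 20 be an integer, q = 2^n (so q ≥ 2^{20}), and A, B, C, D, E ∈ 𝔽_{q²} such that neither condition (C1) nor condition (C2) holds, B = 0, and A C^q + D = 0. If A^{q+1} ≠ 1 and C^{q+1} = 1, then the Dillon hexanomial f_{A,B,C,D,E} is not APN. -/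
/-- In a finite field with `2 ^ (2 * n)` elements, the equation `x ^ 2 ^ n = C * x` has at least
`2 ^ n` solutions when `C` has norm one over the subfield with `2 ^ n` elements. -/
theorem le_ncard_pow_eq_mul {F : Type*} [Field F] [Fintype F] [CharP F 2] {n q : ℕ}
    (hq : q = 2 ^ n) (hF : Fintype.card F = q ^ 2) {C : F} (hC : C ^ (q + 1) = 1) :
    q ≤ Set.ncard {x : F | x ^ q = C * x} := by
  have hconj (x : F) : (x ^ q) ^ q = x := by
    rw [← pow_mul, ← sq, ← hF, FiniteField.pow_card]
  have hadd (x y : F) : (x + y) ^ q = x ^ q + y ^ q := by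
    rw [hq, add_pow_char_pow]
  have hC' : C ^ q * C = 1 := by rw [← pow_succ, hC]
  let φ : F →+ F := AddMonoidHom.mk' (fun x => x + C ^ q * x ^ q) fun x y => by
    rw [hadd]
    ring
  have hker : (φ.ker : Set F) = {x : F | x ^ q = C * x} := by
    ext x
    change x + C ^ q * x ^ q = 0 ↔ x ^ q = C * x
    rw [CharTwo.add_eq_zero]
    constructor <;> intro h
    · linear_combination (-x ^ q) * hC' - C * h
    · linear_combination (-x) * hC' - C ^ q * h
  have hrange : φ.range ≤ φ.ker := by
    rintro _ ⟨x, rfl⟩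
    rw [← SetLike.mem_coe, hker]
    change (x + C ^ q * x ^ q) ^ q = C * (x + C ^ q * x ^ q)
    rw [hadd, mul_pow, hconj, hconj]
    linear_combination (-x ^ q) * hC'
  have hcard : Nat.card φ.ker * Nat.card φ.range = q ^ 2 := by
    rw [← AddSubgroup.index_ker, AddSubgroup.card_mul_index, Nat.card_eq_fintype_card, hF]
  have hle : Nat.card φ.range ≤ Nat.card φ.ker := AddSubgroup.card_le_of_le hrange
  rw [← hker, ← Nat.card_coe_set_eq]
  change q ≤ Nat.card φ.ker
  nlinarith

theorem statement6 (n q : ℕ) (hn : 20 ≤ n) (hq : q = 2 ^ n)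
    (F : Type) [Field F] [Fintype F] (hF : Fintype.card F = q ^ 2)
    (A B C D E : F)
    (hC1 : ¬ CondC1 q A B C D E) (hC2 : ¬ CondC2 q A B C D E)
    (hB : B = 0) (hD : A * C ^ q + D = 0)
    (hA : A ^ (q + 1) ≠ 1) (hC : C ^ (q + 1) = 1) :
    ¬ IsAPN (dillon q A B C D E) := by
  subst hB
  have : CharP F 2 := by
    apply charP_of_card_eq_prime_pow (f := n * 2)
    rw [hF, hq, pow_mul]
  have hq4 : 4 ≤ q := hq ▸ Nat.pow_le_pow_right two_pos (show 2 ≤ n by omega)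
  have hC' : C ^ q * C = 1 := by rw [← pow_succ, hC]
  have hadd (x y : F) : (x + y) ^ q = x ^ q + y ^ q := by
    rw [hq, add_pow_char_pow]
  have hK := le_ncard_pow_eq_mul hq hF hC
  set K : Set F := {x : F | x ^ q = C * x}
  have hf {x : F} (hx : x ^ q = C * x) : dillon q A 0 C D E x = E * C ^ 2 * x ^ 4 := by
    have hD' : D = -(A * C ^ q) := by linear_combination hD
    have h2 : (2 : F) = 0 := CharTwo.two_eq_zero
    simp only [dillon, pow_add, pow_mul, mul_comm 2 q, mul_comm 3 q, hx, hD']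
    linear_combination (-A * x ^ 3) * hC' + C ^ 3 * x ^ 3 * h2
  obtain ⟨a, ha, ha0⟩ : ∃ a ∈ K, a ≠ 0 := Set.exists_ne_of_one_lt_ncard (by omega) 0
  intro hAPN
  have hsub : K ⊆ {x | dillon q A 0 C D E (x + a) + dillon q A 0 C D E x = E * C ^ 2 * a ^ 4} := by
    intro x hx
    have hxa : (x + a) ^ q = C * (x + a) := by
      rw [hadd, hx, ha, mul_add]
    have h4 : (x + a) ^ 4 = x ^ 4 + a ^ 4 := add_pow_char_pow x a 2 2
    change _ = _
    rw [hf hxa, hf hx, h4]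
    linear_combination E * C ^ 2 * x ^ 4 * CharTwo.two_eq_zero (R := F)
  have := hAPN a (E * C ^ 2 * a ^ 4) ha0
  have := Set.ncard_le_ncard hsub (Set.toFinite _)
  omega
end

section
/- There exists a positive integer n₀ such that for every integer n ≥ n₀, setting q = 2^n, and for all A, B, C, D, E ∈ 𝔽_{q²} such that neither condition (C1) nor condition (C2) holds and B = 0: if the Dillon hexanomial f_{A,B,C,D,E} is APN, then (A C^q + D)·E = 0. -/
open Polynomial

section

variable {F : Type*} [Field F]

/-- The cubic part of `f (a * u + a) + f (a * u) + f a`, divided by `a ^ 3`, where `z = a ^ (q - 1)`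
and `v = u ^ q`. -/
def cubicPart (A C D z u v : F) : F :=
  A * (u ^ 2 + u) + C * z ^ 2 * (u + v ^ 2) + D * z * (u ^ 2 + v) + z ^ 3 * (v ^ 2 + v)

lemma eq_zero_of_eval_pow_eq_zero [Fintype F] {m : ℕ} (hm : 0 < m) {p : F[X]}
    (hdeg : p.natDegree * m + 1 < Fintype.card F) (h : ∀ a : F, a ≠ 0 → p.eval (a ^ m) = 0) :
    p = 0 := by
  classical
  have hcomp : p.comp (X ^ m) = 0 := by
    refine eq_zero_of_natDegree_lt_card_of_eval_eq_zero' _ ((Finset.univ : Finset F).erase 0)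
      (fun a ha => ?_) ?_
    · simpa [eval_comp] using h a (Finset.ne_of_mem_erase ha)
    · rw [natDegree_comp, natDegree_X_pow, Finset.card_erase_of_mem (Finset.mem_univ _),
        Finset.card_univ]
      omega
  rw [← expand_eq_comp_X_pow, expand_eq_zero hm] at hcomp
  exact hcomp

lemma dillon_eq (q : ℕ) (A C D E x : F) :
    dillon q A 0 C D E x = A * x ^ 3 + C * (x * (x ^ q) ^ 2) + D * (x ^ 2 * x ^ q) +
      E * (x ^ 2 * (x ^ q) ^ 2) + (x ^ q) ^ 3 := by
  simp only [dillon]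
  ring

/-- If `f` is APN then no point `u` outside `𝔽_q` solves the equation obtained by eliminating the
scaling parameter of `𝔽_q`, unless the cubic part vanishes. -/
lemma cubicPart_eq_zero_of_isAPN [Finite F] [CharP F 2] {q : ℕ} {A C D E : F} {σ : F →+* F}
    (hσq : ∀ x, σ x = x ^ q) (hσσ : ∀ x, σ (σ x) = x) (hE : E ≠ 0)
    (hf : IsAPN (dillon q A 0 C D E)) {a z u : F} (ha : a ≠ 0) (hz : z * σ z = 1)
    (haz : σ a = z * a) (hu : σ u ≠ u)
    (h : σ E * cubicPart A C D z u (σ u) + E * z ^ 3 * σ (cubicPart A C D z u (σ u)) = 0) :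
    cubicPart A C D z u (σ u) = 0 := by
  by_contra hG
  set G := cubicPart A C D z u (σ u) with hGdef
  have hz0 : z ≠ 0 := left_ne_zero_of_mul_eq_one hz
  have ht : u + σ u ≠ 0 := fun h0 => hu (CharTwo.add_eq_zero.1 h0).symm
  set t := u + σ u with htdef
  have hσt : σ t = t := by rw [htdef, map_add, hσσ, add_comm]
  have hE' : σ E ≠ 0 := (map_ne_zero σ).2 hE
  obtain ⟨l, hl⟩ : ∃ l, l * (E * z ^ 2 * a * t ^ 2) = G :=
    ⟨G / (E * z ^ 2 * a * t ^ 2), div_mul_cancel₀ _ (by simp [hE, hz0, ha, ht])⟩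
  have hl0 : l ≠ 0 := by
    rintro rfl
    exact hG (by rw [← hl, zero_mul])
  have hlσ : σ l = l := by
    have h1 : σ l * (σ E * σ z ^ 2 * (z * a) * t ^ 2) = σ G := by
      rw [← hl]; simp only [map_mul, map_pow, haz, hσt]
    have h3 : (σ l + l) * (E * σ E * z ^ 2 * a * t ^ 2) = 0 := by
      rw [← h1, ← hl] at h
      linear_combination h - E * σ l * σ E * a * t ^ 2 * z ^ 2 * (z * σ z + 1) * hz
    rcases mul_eq_zero.1 h3 with h4 | h4
    · exact CharTwo.add_eq_zero.1 h4
    · exact absurd h4 (by simp [hE, hE', hz0, ha, ht])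
  have hc : l * a ≠ 0 := mul_ne_zero hl0 ha
  have hu0 : u ≠ 0 := by rintro rfl; exact hu (map_zero σ)
  have hu1 : u ≠ 1 := by rintro rfl; exact hu (map_one σ)
  have hvan : ∀ x ∈ ({0, l * a, l * a * u} : Set F),
      dillon q A 0 C D E (x + l * a) + dillon q A 0 C D E x = dillon q A 0 C D E (l * a) := by
    simp only [dillon_eq, ← hσq, Set.mem_insert_iff, Set.mem_singleton_iff]
    rintro x (rfl | rfl | rfl)
    · simp
    · simp [CharTwo.add_self_eq_zero]
    · simp only [map_add, map_mul, haz, hlσ]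
      rw [hGdef, cubicPart, htdef] at hl
      linear_combination (norm := (ring_nf; reduce_mod_char!)) l ^ 3 * a ^ 3 * hl
  have hsub : ({0, l * a, l * a * u} : Set F) ⊆
      {x | dillon q A 0 C D E (x + l * a) + dillon q A 0 C D E x = dillon q A 0 C D E (l * a)} :=
    hvan
  have hcard : ({0, l * a, l * a * u} : Set F).ncard = 3 :=
    Set.ncard_eq_three.2 ⟨_, _, _, hc.symm, (mul_ne_zero hc hu0).symm,
      fun h0 => hu1 (mul_left_cancel₀ hc (by rw [← h0, mul_one])), rfl⟩
  have := Set.ncard_le_ncard hsub (Set.toFinite _)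
  have := hf (l * a) (dillon q A 0 C D E (l * a)) hc
  omega

lemma le_card_ker [Fintype F] {q : ℕ} (hq : 1 < q) (hF : Fintype.card F = q ^ 2) (H : F →+ F)
    (c : F) (hH : ∀ u, H u ^ q = c * H u) : q ≤ Nat.card H.ker := by
  classical
  have hP : (X ^ q - C c * X : F[X]).natDegree = q := by
    rw [natDegree_sub_eq_left_of_natDegree_lt, natDegree_X_pow]
    exact (natDegree_C_mul_le c X).trans_lt (by rwa [natDegree_X, natDegree_X_pow])
  have hP0 : (X ^ q - C c * X : F[X]) ≠ 0 := by
    intro h0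
    rw [h0, natDegree_zero] at hP
    omega
  have hrange : Nat.card H.range ≤ q := by
    have hsub : (H.range : Set F) ⊆ ((X ^ q - C c * X : F[X]).roots.toFinset : Set F) := by
      rintro _ ⟨u, rfl⟩
      simp [hP0, hH]
    calc Nat.card H.range ≤ ((X ^ q - C c * X : F[X]).roots.toFinset : Set F).ncard :=
          Set.ncard_le_ncard hsub (Set.toFinite _)
      _ = (X ^ q - C c * X : F[X]).roots.toFinset.card := Set.ncard_coe_finset _
      _ ≤ q := (Multiset.toFinset_card_le _).trans ((card_roots' _).trans hP.le)
  have hmul : Nat.card H.ker * Nat.card H.range = q ^ 2 := by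
    rw [← AddSubgroup.index_ker, AddSubgroup.card_mul_index, Nat.card_eq_fintype_card, hF]
  by_contra! hlt
  nlinarith [Nat.mul_le_mul_left (Nat.card H.ker) hrange]

/-- Two additive polynomials in `u` and `v = u ^ q` of degree `2` with more than four common zeros
are proportional, unless the first one is degenerate. -/
lemma proportional_of_four_lt_card [CharP F 2] {k k' g α β γ : F} {σ : F → F} {S : Finset F}
    (hS : 4 < S.card) (hk' : k' ≠ 0) (hdeg : (k + k') * (k * k' + g ^ 2) ≠ 0)
    (h1 : ∀ u ∈ S, k * u ^ 2 + (k + g) * u + k' * σ u ^ 2 + (k' + g) * σ u = 0)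
    (h2 : ∀ u ∈ S, α * u ^ 2 + (α + γ) * u + β * σ u ^ 2 + (β + γ) * σ u = 0) :
    β * g = k' * γ ∧ β * k = k' * α := by
  set c₁ := β * k + k' * α with hc₁
  set c₂ := β * (k + g) + k' * (α + γ) with hc₂
  set c₃ := β * g + k' * γ with hc₃
  have h3 : ∀ u ∈ S, c₁ * u ^ 2 + c₂ * u + c₃ * σ u = 0 := fun u hu => by
    rw [hc₁, hc₂, hc₃]
    linear_combination (norm := (ring_nf; reduce_mod_char!)) β * h1 u hu + k' * h2 u hu
  have hpoly : ∀ p : F[X], p.natDegree ≤ 4 → (∀ u ∈ S, p.eval u = 0) → p = 0 := fun p hp h =>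
    eq_zero_of_natDegree_lt_card_of_eval_eq_zero' p S h (by omega)
  by_cases h0 : c₃ = 0
  · have hp := hpoly (C c₁ * X ^ 2 + C c₂ * X) (by compute_degree!) fun u hu => by
      simpa [h0] using h3 u hu
    have e1 : c₁ = 0 := by
      simpa [coeff_X, -map_add, -map_mul, -map_pow] using congrArg (fun p => coeff p 2) hp
    exact ⟨CharTwo.add_eq_zero.1 h0, CharTwo.add_eq_zero.1 e1⟩
  · have hp := hpoly (C (k' * c₁ ^ 2) * X ^ 4 +
        C (k * c₃ ^ 2 + k' * c₂ ^ 2 + (k' + g) * c₁ * c₃) * X ^ 2 +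
        C ((k + g) * c₃ ^ 2 + (k' + g) * c₂ * c₃) * X) (by compute_degree!) fun u hu => by
      simp only [eval_add, eval_mul, eval_C, eval_pow, eval_X]
      linear_combination (norm := (ring_nf; reduce_mod_char!)) c₃ ^ 2 * h1 u hu +
        (k' * (c₁ * u ^ 2 + c₂ * u + c₃ * σ u) + (k' + g) * c₃) * h3 u hu
    have e4 : k' * c₁ ^ 2 = 0 := by
      simpa [coeff_X, -map_add, -map_mul, -map_pow] using congrArg (fun p => coeff p 4) hp
    have e2 : k * c₃ ^ 2 + k' * c₂ ^ 2 + (k' + g) * c₁ * c₃ = 0 := by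
      simpa [coeff_X, -map_add, -map_mul, -map_pow] using congrArg (fun p => coeff p 2) hp
    have e1 : (k + g) * c₃ ^ 2 + (k' + g) * c₂ * c₃ = 0 := by
      simpa [coeff_X, -map_add, -map_mul, -map_pow] using congrArg (fun p => coeff p 1) hp
    have e0 : c₁ = 0 := by simpa [hk'] using e4
    have e1' : (k + g) * c₃ + (k' + g) * c₂ = 0 := by
      have : c₃ * ((k + g) * c₃ + (k' + g) * c₂) = 0 := by linear_combination e1
      exact (mul_eq_zero.1 this).resolve_left h0
    rw [e0] at e2
    have : c₃ ^ 2 * ((k + k') * (k * k' + g ^ 2)) = 0 := by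
      linear_combination (norm := (ring_nf; reduce_mod_char!))
        k' * ((k + g) * c₃ + (k' + g) * c₂) * e1' + (k' + g) ^ 2 * e2
    exact absurd this (mul_ne_zero (pow_ne_zero 2 h0) hdeg)

lemma map_mul_cubicPart_add {A C D E K L : F} {σ : F →+* F}
    (hσσ : ∀ x, σ (σ x) = x) (hK : K = σ E * A + E) (hL : L = σ E * D + E * σ C) {z : F}
    (hz : z * σ z = 1) (u : F) :
    σ E * cubicPart A C D z u (σ u) + E * z ^ 3 * σ (cubicPart A C D z u (σ u)) =
      (K + L * z) * u ^ 2 + (K + σ L * z ^ 2) * u + (σ K * z ^ 3 + σ L * z ^ 2) * σ u ^ 2 +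
        (σ K * z ^ 3 + L * z) * σ u := by
  have hz0 : z ≠ 0 := left_ne_zero_of_mul_eq_one hz
  have hσz : σ z = z⁻¹ := eq_inv_of_mul_eq_one_right hz
  rw [hK, hL, cubicPart]
  simp only [map_add, map_mul, map_pow, hσσ, hσz]
  field_simp
  ring

lemma map_eq_pow_mul_and_pow_mul_map {q : ℕ} (hq : 0 < q) {σ : F →+* F}
    (hσq : ∀ x, σ x = x ^ q) (hσσ : ∀ x, σ (σ x) = x) {a : F} (ha : a ≠ 0) :
    σ a = a ^ (q - 1) * a ∧ a ^ (q - 1) * σ (a ^ (q - 1)) = 1 := by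
  have haz : σ a = a ^ (q - 1) * a := by
    rw [hσq, ← pow_succ, Nat.sub_add_cancel hq]
  refine ⟨haz, mul_right_cancel₀ ha ?_⟩
  have h1 := hσσ a
  rw [haz, map_mul, haz] at h1
  linear_combination h1

/-- For APN `f`, any `z = a ^ (q - 1)` satisfies one of three equations in `z` and `σ z = z⁻¹`. -/
lemma vanishing_of_isAPN [Fintype F] [CharP F 2] {q : ℕ} (hq : 4 < q)
    (hF : Fintype.card F = q ^ 2) {A C D E K L : F} {σ : F →+* F}
    (hσq : ∀ x, σ x = x ^ q) (hσσ : ∀ x, σ (σ x) = x) (hE : E ≠ 0)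
    (hK : K = σ E * A + E) (hL : L = σ E * D + E * σ C)
    (hf : IsAPN (dillon q A 0 C D E)) {a z : F} (ha : a ≠ 0) (hz : z * σ z = 1)
    (haz : σ a = z * a) :
    (K + L * z + σ L * z ^ 2 + σ K * z ^ 3) *
      ((K * σ L + L ^ 2) * z ^ 2 + (K * σ K + L * σ L) * z ^ 3 + (σ K * L + σ L ^ 2) * z ^ 4) *
      ((C * z ^ 2 + D * z) * (σ C * z + 1) + (σ C * z + σ D * z ^ 2) * (A + D * z)) = 0 := by
  classical
  have hz0 : z ≠ 0 := left_ne_zero_of_mul_eq_one hz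
  set k := K + L * z with hk
  set k' := σ K * z ^ 3 + σ L * z ^ 2 with hk'
  set g := L * z + σ L * z ^ 2 with hg
  have hσz : σ z = z⁻¹ := eq_inv_of_mul_eq_one_right hz
  have hσk : z ^ 3 * σ k = k' := by
    rw [hk, hk']; simp only [map_add, map_mul, hσz]; field_simp
  have hσk' : z ^ 3 * σ k' = k := by
    rw [hk, hk']; simp only [map_add, map_mul, map_pow, hσσ, hσz]; field_simp
  have hσg : z ^ 3 * σ g = g := by
    rw [hg]; simp only [map_add, map_mul, map_pow, hσσ, hσz]; field_simp; ring
  by_contra hne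
  have hkk : k + k' ≠ 0 := fun h0 => hne <| by
    rw [hk, hk'] at h0
    linear_combination h0 * ((K * σ L + L ^ 2) * z ^ 2 + (K * σ K + L * σ L) * z ^ 3 +
      (σ K * L + σ L ^ 2) * z ^ 4) *
      ((C * z ^ 2 + D * z) * (σ C * z + 1) + (σ C * z + σ D * z ^ 2) * (A + D * z))
  have hdeg : k * k' + g ^ 2 ≠ 0 := fun h0 => hne <| by
    have : (K * σ L + L ^ 2) * z ^ 2 + (K * σ K + L * σ L) * z ^ 3 +
        (σ K * L + σ L ^ 2) * z ^ 4 = 0 := by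
      rw [← h0, hk, hk', hg]
      linear_combination (norm := (ring_nf; reduce_mod_char!))
    rw [this, mul_zero, zero_mul]
  have hk0 : k' ≠ 0 := by
    rintro h0
    apply hkk
    rw [h0, ← hσk', h0, map_zero, mul_zero, add_zero]
  let H : F →+ F := AddMonoidHom.mk'
    (fun u => k * u ^ 2 + (k + g) * u + k' * σ u ^ 2 + (k' + g) * σ u) fun u v => by
      simp only [map_add]
      linear_combination (norm := (ring_nf; reduce_mod_char!))
  have hHdef : ∀ u, H u = k * u ^ 2 + (k + g) * u + k' * σ u ^ 2 + (k' + g) * σ u := fun _ => rfl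
  have hcard : q ≤ Nat.card H.ker := by
    refine le_card_ker (by omega) hF H (z ^ 3)⁻¹ fun u => ?_
    rw [← hσq, eq_inv_mul_iff_mul_eq₀ (pow_ne_zero 3 hz0), hHdef]
    simp only [map_add, map_mul, map_pow, hσσ]
    linear_combination (u + σ u) * hσg + (σ u ^ 2 + σ u) * hσk + (u ^ 2 + u) * hσk'
  set α := A + D * z with hα
  set β := C * z ^ 2 + z ^ 3 with hβ
  set γ := C * z ^ 2 + D * z with hγ
  have hG : ∀ u, cubicPart A C D z u (σ u) =
      α * u ^ 2 + (α + γ) * u + β * σ u ^ 2 + (β + γ) * σ u := fun u => by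
    rw [cubicPart, hα, hβ, hγ]
    linear_combination (norm := (ring_nf; reduce_mod_char!))
  have hker : ∀ u, H u = 0 → cubicPart A C D z u (σ u) = 0 := fun u hu => by
    rw [hHdef] at hu
    by_cases hfix : σ u = u
    · have h0 : (k + k') * (u ^ 2 + u) = 0 := by
        rw [hfix] at hu
        linear_combination (norm := (ring_nf; reduce_mod_char!)) hu
      rw [hG, hfix]
      linear_combination (norm := (ring_nf; reduce_mod_char!))
        (α + β) * (mul_eq_zero.1 h0).resolve_left hkk
    · refine cubicPart_eq_zero_of_isAPN hσq hσσ hE hf ha hz haz hfix ?_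
      rw [map_mul_cubicPart_add hσσ hK hL hz, ← hu, hk, hk', hg]
      linear_combination (norm := (ring_nf; reduce_mod_char!))
  have hS : 4 < (Finset.univ.filter fun u => H u = 0).card := by
    refine lt_of_lt_of_le hq (hcard.trans_eq ?_)
    rw [Nat.card_eq_fintype_card, ← Fintype.card_subtype]
    exact Fintype.card_congr (Equiv.refl _)
  obtain ⟨e1, e2⟩ := proportional_of_four_lt_card (k := k) (k' := k') (g := g) (α := α) (β := β)
    (γ := γ) (σ := σ) (S := Finset.univ.filter fun u => H u = 0) hS hk0 (mul_ne_zero hkk hdeg)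
    (fun u hu => by rw [← hHdef]; simpa using hu)
    (fun u hu => by rw [← hG]; exact hker u (by simpa using hu))
  have e1' : σ β * g = k * σ γ := by
    have := congrArg σ e1
    simp only [map_mul] at this
    rw [← hσg, ← hσk']
    linear_combination z ^ 3 * this
  have e3 : k' * (σ β * γ + α * σ γ) = 0 := by
    linear_combination (norm := (ring_nf; reduce_mod_char!))
      σ γ * e2 + β * e1' + σ β * e1
  have e4 := (mul_eq_zero.1 e3).resolve_left hk0
  apply hne
  have e5 : z ^ 3 * (σ β * γ + α * σ γ) = ((C * z ^ 2 + D * z) * (σ C * z + 1) +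
      (σ C * z + σ D * z ^ 2) * (A + D * z)) := by
    rw [hα, hβ, hγ]
    simp only [map_add, map_mul, map_pow, hσz]
    field_simp
  rw [← e5, e4, mul_zero, mul_zero]

/-- The degenerate case of `vanishing_of_isAPN`, in which the second factor vanishes identically. -/
lemma eq_of_isAPN_of_degenerate [Fintype F] [CharP F 2] {q : ℕ} (hq : 4 < q)
    (hF : Fintype.card F = q ^ 2) {A C D E K L : F} {σ : F →+* F}
    (hσq : ∀ x, σ x = x ^ q) (hσσ : ∀ x, σ (σ x) = x) (hE : E ≠ 0)
    (hK : K = σ E * A + E) (hL : L = σ E * D + E * σ C)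
    (hf : IsAPN (dillon q A 0 C D E)) (hL0 : L ≠ 0) (hKL : K * σ L = L ^ 2) :
    D = A * σ C := by
  have hσL0 : σ L ≠ 0 := (map_ne_zero σ).2 hL0
  have hKL' : σ K * L = σ L ^ 2 := by simpa [hσσ] using congrArg σ hKL
  obtain ⟨l, hl0, hl1, hlσ⟩ : ∃ l : F, l ≠ 0 ∧ l ≠ 1 ∧ σ l = l := by
    by_contra! hno
    have h0 : (X - Polynomial.C 1 : F[X]) = 0 :=
      eq_zero_of_eval_pow_eq_zero (m := q + 1) (by omega)
        (by rw [hF, natDegree_X_sub_C]; nlinarith) fun a ha => by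
          by_contra hne
          refine hno (a ^ (q + 1)) (pow_ne_zero _ ha) (fun h1 => hne (by simp [h1])) ?_
          rw [pow_succ, ← hσq, map_mul, hσσ, mul_comm]
    exact X_sub_C_ne_zero _ h0
  have hfactor : ∀ a : F, a ≠ 0 → ((Polynomial.C (σ L) * X - Polynomial.C L) *
      (Polynomial.C (A * σ L + D * L) + Polynomial.C (C * σ L + L) * X ^ 2)).eval
        (a ^ (q - 1)) = 0 := by
    intro a ha
    obtain ⟨haz, hz⟩ := map_eq_pow_mul_and_pow_mul_map (by omega) hσq hσσ ha
    generalize a ^ (q - 1) = z at haz hz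
    have hz0 : z ≠ 0 := left_ne_zero_of_mul_eq_one hz
    have hσz : σ z = z⁻¹ := eq_inv_of_mul_eq_one_right hz
    simp only [eval_mul, eval_sub, eval_add, eval_C, eval_X, eval_pow]
    by_contra hne
    obtain ⟨hz1, hz2⟩ := mul_ne_zero_iff.1 hne
    have hvan : ∀ c : F, c ≠ 0 → σ c = c →
        cubicPart A C D z (c * (σ L * z * a)) (c * (L * a)) = 0 := by
      intro c hc hcσ
      have hu : σ (c * (σ L * z * a)) = c * (L * a) := by
        simp only [map_mul, hσσ, hcσ, haz, hσz]; field_simp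
      rw [← hu]
      refine cubicPart_eq_zero_of_isAPN hσq hσσ hE hf ha hz haz (fun h => hz1 ?_) ?_
      · rw [hu] at h
        have : c * a * (σ L * z - L) = 0 := by linear_combination -h
        exact (mul_eq_zero.1 this).resolve_left (mul_ne_zero hc ha)
      · rw [map_mul_cubicPart_add hσσ hK hL hz, hu]
        linear_combination (norm := (ring_nf; reduce_mod_char!))
          (c ^ 2 * a ^ 2 * z ^ 2 * σ L + c * a * z) * hKL +
          (c ^ 2 * a ^ 2 * z ^ 3 * L + c * a * z ^ 3) * hKL'
    have h1 := hvan 1 one_ne_zero (map_one σ)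
    have h2 := hvan l hl0 hlσ
    have h3 : a * z * (l * (l - 1)) *
        (A * σ L + D * L + (C * σ L + L) * z ^ 2) = 0 := by
      rw [cubicPart] at h1 h2
      linear_combination l ^ 2 * h1 - h2
    exact hz2 ((mul_eq_zero.1 h3).resolve_left
      (by simp [ha, hz0, hl0, sub_eq_zero, hl1]))
  have hprod := eq_zero_of_eval_pow_eq_zero (by omega) ?_ hfactor
  · have hlin : Polynomial.C (σ L) * X - Polynomial.C L ≠ 0 := fun h0 => hσL0 <| by
      simpa [coeff_X, coeff_C] using congrArg (fun p => coeff p 1) h0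
    have hquad := (mul_eq_zero.1 hprod).resolve_left hlin
    have e0 : A * σ L + D * L = 0 := by
      simpa [-map_add, -map_mul] using congrArg (fun p => coeff p 0) hquad
    have e2 : C * σ L + L = 0 := by
      simpa [coeff_C, -map_add, -map_mul] using congrArg (fun p => coeff p 2) hquad
    have e2' : σ C * L + σ L = 0 := by simpa [hσσ] using congrArg σ e2
    refine mul_right_cancel₀ hL0 ?_
    linear_combination e0 - A * e2'
  · have hdeg : ((Polynomial.C (σ L) * X - Polynomial.C L) *
        (Polynomial.C (A * σ L + D * L) + Polynomial.C (C * σ L + L) * X ^ 2)).natDegree ≤ 3 := by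
      compute_degree!
    have := Nat.mul_le_mul_right (q - 1) hdeg
    rw [hF]
    obtain ⟨r, rfl⟩ : ∃ r, q = r + 1 := ⟨q - 1, by omega⟩
    simp only [Nat.add_sub_cancel] at *
    nlinarith

/-- For APN `f` with `B = 0` and `E ≠ 0` one has `D = A * C ^ q`. -/
lemma eq_mul_of_isAPN [Fintype F] [CharP F 2] {q : ℕ} (hq : 10 ≤ q)
    (hF : Fintype.card F = q ^ 2) {A C D E : F} {σ : F →+* F}
    (hσq : ∀ x, σ x = x ^ q) (hσσ : ∀ x, σ (σ x) = x) (hE : E ≠ 0)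
    (hf : IsAPN (dillon q A 0 C D E)) : D = A * σ C := by
  obtain ⟨K, hK⟩ : ∃ K, K = σ E * A + E := ⟨_, rfl⟩
  obtain ⟨L, hL⟩ : ∃ L, L = σ E * D + E * σ C := ⟨_, rfl⟩
  have hσE : σ E ≠ 0 := (map_ne_zero σ).2 hE
  have hzero : K = 0 → L = 0 → D = A * σ C := fun hK0 hL0 => by
    refine mul_left_cancel₀ hσE ?_
    rw [hK0] at hK
    rw [hL0] at hL
    linear_combination σ C * hK - hL
  set P₁ : F[X] := Polynomial.C K + Polynomial.C L * X + Polynomial.C (σ L) * X ^ 2 +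
    Polynomial.C (σ K) * X ^ 3 with hP₁
  set P₂ : F[X] := Polynomial.C (K * σ L + L ^ 2) * X ^ 2 +
    Polynomial.C (K * σ K + L * σ L) * X ^ 3 + Polynomial.C (σ K * L + σ L ^ 2) * X ^ 4 with hP₂
  set P₃ : F[X] := Polynomial.C (D + A * σ C) * X +
    Polynomial.C (C + A * σ D + 2 * (σ C * D)) * X ^ 2 +
    Polynomial.C (C * σ C + D * σ D) * X ^ 3 with hP₃
  have hP : P₁ * P₂ * P₃ = 0 := by
    refine eq_zero_of_eval_pow_eq_zero (m := q - 1) (by omega) ?_ fun a ha => ?_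
    · have hdeg : (P₁ * P₂ * P₃).natDegree ≤ 10 := by
        have h1 : P₁.natDegree ≤ 3 := by rw [hP₁]; compute_degree!
        have h2 : P₂.natDegree ≤ 4 := by rw [hP₂]; compute_degree!
        have h3 : P₃.natDegree ≤ 3 := by rw [hP₃]; compute_degree!
        exact natDegree_mul_le_of_le (natDegree_mul_le_of_le h1 h2) h3
      have := Nat.mul_le_mul_right (q - 1) hdeg
      rw [hF]
      obtain ⟨r, rfl⟩ : ∃ r, q = r + 1 := ⟨q - 1, by omega⟩
      simp only [Nat.add_sub_cancel] at *
      nlinarith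
    · obtain ⟨haz, hz⟩ := map_eq_pow_mul_and_pow_mul_map (by omega) hσq hσσ ha
      rw [← vanishing_of_isAPN (by omega) hF hσq hσσ hE hK hL hf ha hz haz, hP₁, hP₂, hP₃]
      simp only [eval_mul, eval_add, eval_C, eval_X, eval_pow]
      ring
  rcases mul_eq_zero.1 hP with h12 | h3
  · rcases mul_eq_zero.1 h12 with h1 | h2
    · refine hzero ?_ ?_
      · simpa [hP₁, coeff_X, coeff_C] using congrArg (fun p => coeff p 0) h1
      · simpa [hP₁, coeff_X, coeff_C] using congrArg (fun p => coeff p 1) h1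
    · have e2 : K * σ L + L ^ 2 = 0 := by
        simpa [hP₂, coeff_X, -map_add, -map_mul, -map_pow] using
          congrArg (fun p => coeff p 2) h2
      have e3 : K * σ K + L * σ L = 0 := by
        simpa [hP₂, coeff_X, -map_add, -map_mul, -map_pow] using
          congrArg (fun p => coeff p 3) h2
      by_cases hL0 : L = 0
      · exact hzero (by simpa [hL0] using e3) hL0
      · exact eq_of_isAPN_of_degenerate (by omega) hF hσq hσσ hE hK hL hf hL0
          (CharTwo.add_eq_zero.1 e2)
  · have e1 : D + A * σ C = 0 := by
      simpa [hP₃, coeff_X, -map_add, -map_mul] using congrArg (fun p => coeff p 1) h3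
    exact CharTwo.add_eq_zero.1 e1

end

theorem statement8 :
    ∃ n₀ : ℕ, 0 < n₀ ∧ ∀ n : ℕ, n₀ ≤ n → ∀ q : ℕ, q = 2 ^ n →
      ∀ (F : Type) [Field F] [Fintype F], Fintype.card F = q ^ 2 →
        ∀ A B C D E : F,
          ¬ CondC1 q A B C D E → ¬ CondC2 q A B C D E → B = 0 →
          IsAPN (dillon q A B C D E) → (A * C ^ q + D) * E = 0 := by
  refine ⟨4, by norm_num, ?_⟩
  rintro n hn q rfl F _ _ hF A B C D E - - rfl hf
  have hchar : CharP F 2 :=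
    charP_of_card_eq_prime_pow (f := n * 2) (by rw [hF, pow_mul])
  by_cases hE : E = 0
  · rw [hE, mul_zero]
  have hq : 10 ≤ 2 ^ n :=
    le_trans (by norm_num) (Nat.pow_le_pow_right (by norm_num : 0 < 2) hn)
  have hD := eq_mul_of_isAPN hq hF (σ := iterateFrobenius F 2 n)
    (fun x => iterateFrobenius_def 2 n x)
    (fun x => by
      rw [iterateFrobenius_def, iterateFrobenius_def, ← pow_mul, ← sq, ← hF, FiniteField.pow_card])
    hE hf
  rw [iterateFrobenius_def] at hD
  rw [hD, CharTwo.add_self_eq_zero, zero_mul]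
end

section
/- Let n be a positive integer, q = 2^n, A, B, C, D ∈ 𝔽_{q²}, and let Ω be an algebraic closure of 𝔽_{q²}. Suppose A^q B + B^q ≠ 0 and h₁ ≠ 0, where h₁ := A^{q+1} B^{q+1} + A B^{2q} + A^q B² + B² C^q D^q + B^{q+1} C^{q+1} + B^{q+1} D^{q+1} + B^{q+1} + B^{2q} C D. Then the polynomial [(A^q B + B^q) Z₁ + (B D^q + B^q C) Z₀] · [(A B^q + B) Z₀³ + (B C^q + B^q D) Z₀² Z₁ + (B D^q + B^q C) Z₀ Z₁² + (A^q B + B^q) Z₁³] in Ω[Z₀, Z₁] is not the square of any polynomial in Ω[Z₀, Z₁]. -/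
open MvPolynomial in
theorem statement12 (n q : ℕ) (hn : 0 < n) (hq : q = 2 ^ n)
    (F : Type) [Field F] [Fintype F] (hF : Fintype.card F = q ^ 2)
    (Ω : Type) [Field Ω] [Algebra F Ω] [IsAlgClosure F Ω]
    (A B C D : F)
    (hAB : A ^ q * B + B ^ q ≠ 0)
    (hh1 : h1Poly q A B C D ≠ 0) :
    ¬ ∃ p : MvPolynomial (Fin 2) Ω,
      (MvPolynomial.C (algebraMap F Ω (A ^ q * B + B ^ q)) * X 1 +
          MvPolynomial.C (algebraMap F Ω (B * D ^ q + B ^ q * C)) * X 0) *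
        (MvPolynomial.C (algebraMap F Ω (A * B ^ q + B)) * X 0 ^ 3 +
          MvPolynomial.C (algebraMap F Ω (B * C ^ q + B ^ q * D)) * X 0 ^ 2 * X 1 +
          MvPolynomial.C (algebraMap F Ω (B * D ^ q + B ^ q * C)) * X 0 * X 1 ^ 2 +
          MvPolynomial.C (algebraMap F Ω (A ^ q * B + B ^ q)) * X 1 ^ 3) = p ^ 2 := by
  rintro ⟨p, hp⟩
  have hF2 : (2 : F) = 0 := by
    have hcard := Nat.cast_card_eq_zero F
    rw [hF, hq] at hcard
    push_cast at hcard
    exact eq_zero_of_pow_eq_zero (eq_zero_of_pow_eq_zero hcard)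
  have hΩ2 : (2 : Ω) = 0 := by
    rw [← map_ofNat (algebraMap F Ω) 2, hF2, map_zero]
  -- The derivative of a square vanishes in characteristic two; at `(1, 0)` this reads `h₁ = 0`.
  have hd := congrArg (fun f => eval ![1, 0] (pderiv 1 f)) hp
  simp only [Derivation.leibniz, Derivation.leibniz_pow, map_add, pderiv_C, pderiv_X, smul_eq_mul,
    map_mul, map_pow, eval_C, eval_X, map_zero, Pi.single_apply, nsmul_eq_mul, map_natCast] at hd
  simp [hΩ2] at hd
  refine hh1 ((algebraMap F Ω).injective ?_)
  simp only [h1Poly, map_add, map_mul, map_pow, map_zero]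
  linear_combination hd
end
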